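/- Let P be an irreducible row-stochastic matrix on the finite state space S = L_0 ∪ ⋯ ∪ L_N, where L_n = {(n, α) : α = 1, …, m}, and let π = (π_0, …, π_N) be its stationary probability row vector (πP = π, π ≥ 0, total mass 1), partitioned according to levels. For levels i ≠ j, define the taboo matrix L_{i→j}(1) as the m×m matrix whose (α, β) entry is ∑_{k≥1} ∑ ∏_{t=0}^{k−1} P_{x_t, x_{t+1}}, the inner sum ranging over all state sequences x_0 = (i, α), x_1, …, x_k = (j, β) in S with x_t ∉ L_i for 1 ≤ t ≤ k − 1. Then these sums are finite and the block ratio identity π_j = π_i L_{i→j}(1) holds for all levels i ≠ j. -/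

import Mathlib

open Matrix
open scoped BigOperators ENNReal

/-- A nonnegative square matrix indexed by a finite set is irreducible if for every pair of
indices `(x, y)` there exists `k ≥ 1` with `(A^k)_{x,y} > 0`. -/
def Matrix.Irred {ι : Type*} [Fintype ι] [DecidableEq ι] (A : Matrix ι ι ℝ) : Prop :=
  ∀ x y, ∃ k : ℕ, 1 ≤ k ∧ 0 < (A ^ k) x y

/-- The taboo matrix `L_{i→j}(1)` of a finite level-structured chain: the `(α,β)` entry is
the sum over all state sequences `x_0 = (i,α), x_1, …, x_k = (j,β)` (`k ≥ 1`) with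
`x_t ∉ L_i` for `1 ≤ t ≤ k-1` of `∏_{t<k} P_{x_t,x_{t+1}}`, taken in `[0,∞]`. -/
noncomputable def tabooS (m N : ℕ)
    (P : Matrix (Fin (N + 1) × Fin m) (Fin (N + 1) × Fin m) ℝ)
    (i j : Fin (N + 1)) (α β : Fin m) : ℝ≥0∞ :=
  ∑' k : ℕ,
    ∑' c : {f : Fin (k + 2) → Fin (N + 1) × Fin m //
        f 0 = (i, α) ∧ f (Fin.last (k + 1)) = (j, β) ∧
          ∀ t : Fin (k + 2), 1 ≤ (t : ℕ) → (t : ℕ) ≤ k → (f t).1 ≠ i},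
      ENNReal.ofReal (∏ t : Fin (k + 1), P (c.1 t.castSucc) (c.1 t.succ))

/-- Entries of a matrix power as a sum over paths. -/
theorem Matrix.pow_apply_eq_sum_paths {S : Type*} [Fintype S] [DecidableEq S]
    (M : Matrix S S ℝ) (k : ℕ) (x y : S) :
    (M ^ k) x y = ∑ f : Fin (k + 1) → S,
      if f 0 = x ∧ f (Fin.last k) = y then ∏ t : Fin k, M (f t.castSucc) (f t.succ) else 0 := by
  induction k generalizing x with
  | zero =>
    rw [← (Equiv.funUnique (Fin 1) S).symm.sum_comp]
    simp only [pow_zero, Matrix.one_apply, Equiv.funUnique_symm_apply, uniqueElim_const,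
      Finset.univ_eq_empty, Finset.prod_empty]
    by_cases h : x = y
    · subst h
      simp
    · rw [if_neg h]
      refine (Finset.sum_eq_zero fun z _ => if_neg ?_).symm
      rintro ⟨rfl, rfl⟩
      exact h rfl
  | succ k ih =>
    have h_last (z : S) (f : Fin (k + 1) → S) :
        (Fin.cons z f : Fin (k + 2) → S) (Fin.last (k + 1)) = f (Fin.last k) := by
      rw [← Fin.succ_last, Fin.cons_succ]
    have h_cons (z : S) (f : Fin (k + 1) → S) :
        Fin.consEquiv (fun _ : Fin (k + 2) => S) (z, f) = Fin.cons z f := rfl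
    rw [← (Fin.consEquiv fun _ : Fin (k + 2) => S).sum_comp, Fintype.sum_prod_type,
      Finset.sum_eq_single x]
    · simp only [h_cons, h_last, Fin.cons_zero, true_and, Fin.prod_univ_succ,
        Fin.castSucc_zero, Fin.cons_succ, ← Fin.succ_castSucc, pow_succ', Matrix.mul_apply, ih,
        Finset.mul_sum]
      rw [Finset.sum_comm]
      refine Finset.sum_congr rfl fun f _ => ?_
      rw [Finset.sum_eq_single (f 0)]
      · simp
      · intro z _ hz
        simp [hz.symm]
      · simp
    · intro z _ hz
      refine Finset.sum_eq_zero fun f _ => if_neg ?_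
      simp [hz]
    · simp

/-- Zeroing out the columns of a matrix indexed by a taboo set. -/
def Matrix.tabooCols {S : Type*} (P : Matrix S S ℝ) (A : S → Prop) [DecidablePred A] :
    Matrix S S ℝ :=
  fun x y => if A y then 0 else P x y

theorem Matrix.tabooCols_nonneg {S : Type*} {P : Matrix S S ℝ} (hP : ∀ x y, 0 ≤ P x y)
    (A : S → Prop) [DecidablePred A] (x y : S) : 0 ≤ P.tabooCols A x y := by
  unfold tabooCols
  split_ifs
  exacts [le_rfl, hP x y]

/-- A nonnegative invariant vector of an irreducible matrix vanishes if one entry does. -/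
theorem Matrix.Irred.eq_zero_of_vecMul_eq {S : Type*} [Fintype S] [DecidableEq S]
    {P : Matrix S S ℝ} (hP : ∀ x y, 0 ≤ P x y) (hirr : P.Irred)
    {r : S → ℝ} (hr : ∀ x, 0 ≤ r x) (hrP : r ᵥ* P = r) {a : S} (ha : r a = 0) (x : S) :
    r x = 0 := by
  obtain ⟨k, -, hk⟩ := hirr x a
  have h_pow : ∀ n : ℕ, r ᵥ* P ^ n = r := by
    intro n
    induction n with
    | zero => simp
    | succ n ih => rw [pow_succ, ← Matrix.vecMul_vecMul, ih, hrP]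
  have h_sum : ∑ z, r z * (P ^ k) z a = 0 := (congrFun (h_pow k) a).trans ha
  have h_term := (Finset.sum_eq_zero_iff_of_nonneg fun z _ =>
    mul_nonneg (hr z) (Matrix.pow_apply_nonneg hP k z a)).1 h_sum x (Finset.mem_univ x)
  exact (mul_eq_zero.1 h_term).resolve_right hk.ne'

/-- A nonnegative vector invariant under the taboo matrix of a nonempty set vanishes. -/
theorem Matrix.Irred.eq_zero_of_vecMul_tabooCols_eq {S : Type*} [Fintype S] [DecidableEq S]
    {P : Matrix S S ℝ} (hP : ∀ x y, 0 ≤ P x y) (hrow : ∀ x, ∑ y, P x y = 1) (hirr : P.Irred)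
    {A : S → Prop} [DecidablePred A] {a : S} (ha : A a) {r : S → ℝ} (hr : ∀ x, 0 ≤ r x)
    (hrQ : r ᵥ* P.tabooCols A = r) (x : S) : r x = 0 := by
  have h_le (y : S) : r y ≤ (r ᵥ* P) y := by
    conv_lhs => rw [← hrQ]
    refine Finset.sum_le_sum fun z _ => mul_le_mul_of_nonneg_left ?_ (hr z)
    unfold tabooCols
    split_ifs
    exacts [hP z y, le_rfl]
  have h_total : ∑ y, r y = ∑ y, (r ᵥ* P) y := by
    simp only [Matrix.vecMul, dotProduct]
    rw [Finset.sum_comm]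
    simp [← Finset.mul_sum, hrow]
  have h_inv : r ᵥ* P = r := funext fun y =>
    (((Finset.sum_eq_sum_iff_of_le fun y _ => h_le y).1 h_total) y (Finset.mem_univ y)).symm
  refine hirr.eq_zero_of_vecMul_eq hP hr h_inv (a := a) ?_ x
  rw [← hrQ]
  simp [Matrix.vecMul, dotProduct, tabooCols, ha]

/-- Last-exit decomposition of an invariant vector up to time `n`. -/
theorem Matrix.vecMul_tabooCols_decomposition {S : Type*} [Fintype S] [DecidableEq S]
    {P : Matrix S S ℝ} (A : S → Prop) [DecidablePred A] {π : S → ℝ} (hπ : π ᵥ* P = π)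
    (n : ℕ) (y : S) :
    (if A y then 0 else π y) =
      (∑ k ∈ Finset.range n, ∑ x, (if A x then π x else 0) * (P.tabooCols A ^ (k + 1)) x y) +
        ((fun x => if A x then 0 else π x) ᵥ* P.tabooCols A ^ n) y := by
  induction n with
  | zero => simp
  | succ n ih =>
    have h_step : (fun x => if A x then 0 else π x) =
        (fun x => if A x then π x else 0) ᵥ* P.tabooCols A +
          (fun x => if A x then 0 else π x) ᵥ* P.tabooCols A := by
      rw [← Matrix.add_vecMul]
      funext y
      have h_split : ((fun x => if A x then π x else 0) + fun x => if A x then 0 else π x) = π := by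
        funext x
        by_cases h : A x <;> simp [h]
      rw [h_split]
      by_cases h : A y
      · simp [Matrix.vecMul, dotProduct, tabooCols, h]
      · have := congrFun hπ y
        simpa [Matrix.vecMul, dotProduct, tabooCols, h] using this.symm
    rw [ih, Finset.sum_range_succ, add_assoc]
    congr 1
    conv_lhs => rw [h_step]
    rw [Matrix.add_vecMul, Matrix.vecMul_vecMul, Matrix.vecMul_vecMul, ← pow_succ']
    rfl

/-- Last-exit decomposition of an invariant vector of an irreducible stochastic matrix. -/
theorem Matrix.Irred.hasSum_tabooCols {S : Type*} [Fintype S] [DecidableEq S]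
    {P : Matrix S S ℝ} (hP : ∀ x y, 0 ≤ P x y) (hrow : ∀ x, ∑ y, P x y = 1) (hirr : P.Irred)
    {A : S → Prop} [DecidablePred A] {a : S} (ha : A a) {π : S → ℝ} (hπnn : ∀ x, 0 ≤ π x)
    (hπ : π ᵥ* P = π) {y : S} (hy : ¬ A y) :
    HasSum (fun k : ℕ => ∑ x, (if A x then π x else 0) * (P.tabooCols A ^ (k + 1)) x y)
      (π y) := by
  set Q := P.tabooCols A with hQ
  set u : S → ℝ := fun x => if A x then 0 else π x with hu
  have h_Q (k : ℕ) (x y : S) : 0 ≤ (Q ^ k) x y :=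
    Matrix.pow_apply_nonneg (tabooCols_nonneg hP A) k x y
  have hu_nonneg (x : S) : 0 ≤ u x := by
    simp only [hu]
    split_ifs
    exacts [le_rfl, hπnn x]
  have h_term (z : S) (k : ℕ) :
      0 ≤ ∑ x, (if A x then π x else 0) * (Q ^ (k + 1)) x z := by
    refine Finset.sum_nonneg fun x _ => mul_nonneg ?_ (h_Q _ _ _)
    split_ifs
    exacts [hπnn x, le_rfl]
  have h_rem (n : ℕ) (z : S) : 0 ≤ (u ᵥ* Q ^ n) z :=
    Finset.sum_nonneg fun x _ => mul_nonneg (hu_nonneg x) (h_Q _ _ _)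
  have h_dec (n : ℕ) (z : S) : u z = _ := vecMul_tabooCols_decomposition A hπ n z
  have h_summable (z : S) :
      Summable fun k : ℕ => ∑ x, (if A x then π x else 0) * (Q ^ (k + 1)) x z :=
    summable_of_sum_range_le (c := u z) (h_term z) fun n => by
      have := h_rem n z
      linarith [h_dec n z]
  let r : S → ℝ := fun z =>
    u z - ∑' k : ℕ, ∑ x, (if A x then π x else 0) * (Q ^ (k + 1)) x z
  have h_lim : Filter.Tendsto (fun n : ℕ => u ᵥ* Q ^ n) Filter.atTop (nhds r) := by
    refine tendsto_pi_nhds.2 fun z => ?_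
    refine ((h_summable z).hasSum.tendsto_sum_nat.const_sub (u z)).congr fun n => ?_
    linarith [h_dec n z]
  have hr_nonneg (z : S) : 0 ≤ r z :=
    ge_of_tendsto' (tendsto_pi_nhds.1 h_lim z) fun n => h_rem n z
  have h_cont : Continuous fun v : S → ℝ => v ᵥ* Q := continuous_id.matrix_vecMul continuous_const
  have hrQ : r ᵥ* Q = r := by
    refine tendsto_nhds_unique ((h_cont.tendsto r).comp h_lim)
      ((h_lim.comp (Filter.tendsto_add_atTop_nat 1)).congr fun n => ?_)
    simp [pow_succ, Matrix.vecMul_vecMul]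
  have h_zero : r y = 0 := hirr.eq_zero_of_vecMul_tabooCols_eq hP hrow ha hr_nonneg hrQ y
  have h_eq : π y = ∑' k : ℕ, ∑ x, (if A x then π x else 0) * (Q ^ (k + 1)) x y := by
    have : u y = π y := if_neg hy
    rw [← this]
    exact sub_eq_zero.1 h_zero
  rw [h_eq]
  exact (h_summable y).hasSum

/-- An invariant probability vector of an irreducible matrix is positive. -/
theorem Matrix.Irred.pos_of_vecMul_eq {S : Type*} [Fintype S] [DecidableEq S]
    {P : Matrix S S ℝ} (hP : ∀ x y, 0 ≤ P x y) (hirr : P.Irred) {π : S → ℝ}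
    (hπnn : ∀ x, 0 ≤ π x) (hπsum : ∑ x, π x = 1) (hπ : π ᵥ* P = π) (x : S) : 0 < π x := by
  refine (hπnn x).lt_of_ne fun h => ?_
  simp [hirr.eq_zero_of_vecMul_eq hP hπnn hπ h.symm] at hπsum

theorem Matrix.Irred.summable_tabooCols {S : Type*} [Fintype S] [DecidableEq S]
    {P : Matrix S S ℝ} (hP : ∀ x y, 0 ≤ P x y) (hrow : ∀ x, ∑ y, P x y = 1) (hirr : P.Irred)
    {A : S → Prop} [DecidablePred A] {π : S → ℝ} (hπnn : ∀ x, 0 ≤ π x) (hπsum : ∑ x, π x = 1)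
    (hπ : π ᵥ* P = π) {x y : S} (hx : A x) (hy : ¬ A y) :
    Summable fun k : ℕ => (P.tabooCols A ^ (k + 1)) x y := by
  have h_Q (k : ℕ) (x y : S) : 0 ≤ (P.tabooCols A ^ k) x y :=
    Matrix.pow_apply_nonneg (tabooCols_nonneg hP A) k x y
  rw [← summable_mul_left_iff (hirr.pos_of_vecMul_eq hP hπnn hπsum hπ x).ne']
  refine (hirr.hasSum_tabooCols hP hrow hx hπnn hπ hy).summable.of_nonneg_of_le
    (fun k => mul_nonneg (hπnn x) (h_Q _ _ _)) fun k => ?_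
  refine (le_of_eq (by rw [if_pos hx])).trans (Finset.single_le_sum
    (f := fun x => (if A x then π x else 0) * (P.tabooCols A ^ (k + 1)) x y)
    (fun z _ => mul_nonneg ?_ (h_Q _ _ _)) (Finset.mem_univ x))
  split_ifs
  exacts [hπnn z, le_rfl]

theorem tabooS_eq_tsum {m N : ℕ} {P : Matrix (Fin (N + 1) × Fin m) (Fin (N + 1) × Fin m) ℝ}
    (hP : ∀ x y, 0 ≤ P x y) {i j : Fin (N + 1)} (hij : i ≠ j) (α β : Fin m) :
    tabooS m N P i j α β =
      ∑' k : ℕ, ENNReal.ofReal ((P.tabooCols (fun x => x.1 = i) ^ (k + 1)) (i, α) (j, β)) := by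
  refine tsum_congr fun k => ?_
  rw [tsum_fintype, ← ENNReal.ofReal_sum_of_nonneg fun _ _ => Finset.prod_nonneg fun _ _ => hP _ _,
    Matrix.pow_apply_eq_sum_paths]
  congr 1
  rw [← Finset.sum_subtype (Finset.univ.filter fun f : Fin (k + 2) → Fin (N + 1) × Fin m =>
      f 0 = (i, α) ∧ f (Fin.last (k + 1)) = (j, β) ∧
        ∀ t : Fin (k + 2), 1 ≤ (t : ℕ) → (t : ℕ) ≤ k → (f t).1 ≠ i) (by simp)
    fun f : Fin (k + 2) → Fin (N + 1) × Fin m => ∏ t : Fin (k + 1), P (f t.castSucc) (f t.succ),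
    Finset.sum_filter]
  refine Finset.sum_congr rfl fun f _ => ?_
  by_cases h_ends : f 0 = (i, α) ∧ f (Fin.last (k + 1)) = (j, β)
  · rw [if_pos h_ends]
    split_ifs with h
    · refine Finset.prod_congr rfl fun t _ => (if_neg ?_).symm
      rcases Fin.eq_castSucc_or_eq_last t with ⟨s, rfl⟩ | rfl
      · exact h.2.2 _ (by simp) (by simp)
      · rw [Fin.succ_last, h_ends.2]
        exact hij.symm
    · have : ∃ t : Fin (k + 2), 1 ≤ (t : ℕ) ∧ (f t).1 = i := by
        by_contra! h_avoid
        exact h ⟨h_ends.1, h_ends.2, fun t ht _ => h_avoid t ht⟩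
      obtain ⟨t, ht, hti⟩ := this
      obtain ⟨s, rfl⟩ := Fin.exists_succ_eq.2 (show t ≠ 0 by rintro rfl; simp at ht)
      symm
      exact Finset.prod_eq_zero (Finset.mem_univ s) (if_pos hti)
  · rw [if_neg h_ends, if_neg fun h => h_ends ⟨h.1, h.2.1⟩]

theorem stmt18 (m N : ℕ) (hm : 1 ≤ m)
    (P : Matrix (Fin (N + 1) × Fin m) (Fin (N + 1) × Fin m) ℝ)
    (hPnn : ∀ x y, 0 ≤ P x y) (hProw : ∀ x, ∑ y, P x y = 1)
    (hirr : P.Irred)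
    (π : Fin (N + 1) × Fin m → ℝ)
    (hπnn : ∀ x, 0 ≤ π x) (hπsum : ∑ x, π x = 1) (hπ : π ᵥ* P = π) :
    ∀ i j : Fin (N + 1), i ≠ j →
      (∀ α β, tabooS m N P i j α β ≠ ⊤) ∧
      (∀ β, π (j, β) = ∑ α, π (i, α) * (tabooS m N P i j α β).toReal) := by
  intro i j hij
  have h_not : ¬ j = i := fun h => hij h.symm
  have h_summable (α β : Fin m) : Summable fun k : ℕ =>
      (P.tabooCols (fun x => x.1 = i) ^ (k + 1)) (i, α) (j, β) :=
    hirr.summable_tabooCols hPnn hProw hπnn hπsum hπ rfl h_not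
  have h_taboo (α β : Fin m) : tabooS m N P i j α β = ENNReal.ofReal
      (∑' k : ℕ, (P.tabooCols (fun x => x.1 = i) ^ (k + 1)) (i, α) (j, β)) := by
    rw [tabooS_eq_tsum hPnn hij, ENNReal.ofReal_tsum_of_nonneg (fun k =>
      Matrix.pow_apply_nonneg (tabooCols_nonneg hPnn _) _ _ _) (h_summable α β)]
  refine ⟨fun α β => by rw [h_taboo]; exact ENNReal.ofReal_ne_top, fun β => ?_⟩
  have h_sum := hirr.hasSum_tabooCols hPnn hProw (A := fun x => x.1 = i) (a := (i, ⟨0, hm⟩)) rfl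
    hπnn hπ (y := (j, β)) h_not
  rw [← h_sum.tsum_eq]
  simp only [Fintype.sum_prod_type]
  have h_level (k : ℕ) : (∑ n, ∑ α, (if n = i then π (n, α) else 0) *
      (P.tabooCols (fun x => x.1 = i) ^ (k + 1)) (n, α) (j, β)) =
      ∑ α, π (i, α) * (P.tabooCols (fun x => x.1 = i) ^ (k + 1)) (i, α) (j, β) := by
    rw [Finset.sum_eq_single i]
    · simp
    · intro n _ hn
      simp [hn]
    · simp
  simp only [h_level]
  rw [Summable.tsum_finsetSum fun α _ => (h_summable α β).mul_left _]
  refine Finset.sum_congr rfl fun α _ => ?_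
  rw [tsum_mul_left, h_taboo, ENNReal.toReal_ofReal (tsum_nonneg fun k =>
    Matrix.pow_apply_nonneg (tabooCols_nonneg hPnn _) _ _ _)]
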